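/- For α ∈ (0,1) ∪ (1,∞) and n ≥ 1, the Rényi divergence of order α between the maximum E^(n) of n i.i.d. exponential(1) random variables and an exponential(1) random variable E equals (1/(α-1)) log(n^α / (α(n-1)+1)). -/

import Mathlib

open MeasureTheory Real

theorem renyi_aux (n : ℕ) (hn : 1 ≤ n) (α : ℝ) (hα : 0 < α) :
    (∫ x in Set.Ioi (0:ℝ),
        ((n : ℝ) * (1 - Real.exp (-x)) ^ (n - 1) * Real.exp (-x)) ^ α *
          (Real.exp (-x)) ^ (1 - α)) = (n : ℝ) ^ α / (α * ((n : ℝ) - 1) + 1) := by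
  have hn1 : (1:ℝ) ≤ n := by exact_mod_cast hn
  have hc : 0 ≤ α * ((n : ℝ) - 1) := mul_nonneg hα.le (by linarith)
  set c := α * ((n : ℝ) - 1) with hcdef
  have hpos : ∀ x ∈ Set.Ioi (0:ℝ), 0 < 1 - Real.exp (-x) := by
    intro x hx
    have : Real.exp (-x) < 1 := by
      rw [← Real.exp_zero]
      exact Real.exp_lt_exp.mpr (by simpa using hx)
    linarith
  have h1 : ∀ x ∈ Set.Ioi (0:ℝ),
      ((n : ℝ) * (1 - Real.exp (-x)) ^ (n - 1) * Real.exp (-x)) ^ α *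
          (Real.exp (-x)) ^ (1 - α)
        = (n : ℝ) ^ α * ((1 - Real.exp (-x)) ^ c * Real.exp (-x)) := by
    intro x hx
    have hp := hpos x hx
    have he := Real.exp_pos (-x)
    rw [Real.mul_rpow (by positivity) he.le, Real.mul_rpow (by positivity) (by positivity),
      ← Real.rpow_natCast, ← Real.rpow_mul hp.le, Nat.cast_sub hn, mul_assoc, mul_assoc,
      ← Real.rpow_add he, mul_comm _ α, Nat.cast_one]
    simp [hcdef]
  rw [setIntegral_congr_fun measurableSet_Ioi h1, integral_const_mul]
  have h2 : (∫ x in Set.Ioi (0:ℝ), (1 - Real.exp (-x)) ^ c * Real.exp (-x)) =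
      1 / (c + 1) - (1 - Real.exp (-(0:ℝ))) ^ (c + 1) / (c + 1) := by
    refine integral_Ioi_of_hasDerivAt_of_nonneg
      (g := fun x => (1 - Real.exp (-x)) ^ (c + 1) / (c + 1)) ?_ ?_ ?_ ?_
    · apply Continuous.continuousWithinAt
      exact ((continuous_const.sub (Real.continuous_exp.comp continuous_neg)).rpow_const
        (fun x => Or.inr (by linarith))).div_const _
    · intro x hx
      have hd : HasDerivAt (fun x : ℝ => 1 - Real.exp (-x)) (Real.exp (-x)) x := by
        simpa using ((hasDerivAt_neg x).exp).const_sub 1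
      have := (hd.rpow_const (p := c + 1) (Or.inl (hpos x hx).ne')).div_const (c + 1)
      have he : Real.exp (-x) * (c + 1) * (1 - Real.exp (-x)) ^ (c + 1 - 1) / (c + 1) =
          (1 - Real.exp (-x)) ^ c * Real.exp (-x) := by
        rw [add_sub_cancel_right]
        field_simp
      rw [he] at this
      exact this
    · intro x hx
      have := hpos x hx
      positivity
    · have ht : Filter.Tendsto (fun x : ℝ => 1 - Real.exp (-x)) Filter.atTop (nhds 1) := by
        simpa using Real.tendsto_exp_neg_atTop_nhds_zero.const_sub 1
      simpa using (ht.rpow_const (p := c + 1) (Or.inl one_ne_zero)).div_const (c + 1)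
  rw [h2]
  have : c + 1 ≠ 0 := by positivity
  simp [Real.zero_rpow this, div_eq_mul_inv]

/-- Rényi divergence of order `α` between the maximum of `n` i.i.d. exponential(1)
random variables and an exponential(1) random variable. -/
theorem renyi_max_exponential (n : ℕ) (hn : 1 ≤ n) (α : ℝ)
    (hα : (0 < α ∧ α < 1) ∨ 1 < α) :
    (1 / (α - 1)) * Real.log (∫ x in Set.Ioi (0:ℝ),
        ((n : ℝ) * (1 - Real.exp (-x)) ^ (n - 1) * Real.exp (-x)) ^ α *
          (Real.exp (-x)) ^ (1 - α))
      = (1 / (α - 1)) * Real.log ((n : ℝ) ^ α / (α * ((n : ℝ) - 1) + 1)) := by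
  rw [renyi_aux n hn α (by rcases hα with h | h <;> linarith)]
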